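/- arXiv:2410.13729 — 9 statements merged into one kernel-verified Lean document; each statement's English description precedes it below -/
import Mathlib

section
/- For every integer k ≥ 2, the union of sets of lengths 𝒰ₖᵐ(𝔑) equals ℕ_{≥2}; that is, for every integer l, some numerical semigroup admits both a factorization into irreducibles of length k and a factorization into irreducibles of length l if and only if l ≥ 2. -/
/-- A numerical semigroup: a submonoid of `(ℕ, +)` with finite complement. -/
structure NumericalSemigroup where
  carrier : Set ℕ
  zero_mem : 0 ∈ carrier
  add_mem : ∀ ⦃a b : ℕ⦄, a ∈ carrier → b ∈ carrier → a + b ∈ carrier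
  cofinite : (carrierᶜ : Set ℕ).Finite

/-- A numerical semigroup is irreducible if it is not the intersection of two
numerical semigroups properly containing it. -/
def NumericalSemigroup.Irred (S : NumericalSemigroup) : Prop :=
  ¬ ∃ A B : NumericalSemigroup,
      S.carrier ⊂ A.carrier ∧ S.carrier ⊂ B.carrier ∧
      S.carrier = A.carrier ∩ B.carrier

/-- `F : Fin n → NumericalSemigroup` is a factorization of `S` (of length `n`)
into irreducibles: each factor is irreducible, `S` is the intersection of the
factors, and the intersection cannot be refined (no proper subfamily has
intersection `S`). -/
def IsFactorization (S : NumericalSemigroup) {n : ℕ}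
    (F : Fin n → NumericalSemigroup) : Prop :=
  (∀ j, (F j).Irred) ∧
  S.carrier = ⋂ j, (F j).carrier ∧
  ∀ J : Set (Fin n), J ≠ Set.univ → S.carrier ≠ ⋂ j ∈ J, (F j).carrier

/-- `S` admits a factorization into irreducibles of length `n`. -/
def HasFactorizationOfLength (S : NumericalSemigroup) (n : ℕ) : Prop :=
  ∃ F : Fin n → NumericalSemigroup, IsFactorization S F

/-- The set of lengths `Lᵐ(S)` of factorizations of `S` into irreducibles. -/
def LengthSet (S : NumericalSemigroup) : Set ℕ :=
  {n | HasFactorizationOfLength S n}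

/-- The underlying set of `T(m) = {0} ∪ {(m+1)/2, …, m-1} ∪ {m+1, m+2, …}`. -/
def Tset (m : ℕ) : Set ℕ :=
  {0} ∪ Set.Icc ((m + 1) / 2) (m - 1) ∪ Set.Ici (m + 1)

/-- The underlying set of the numerical semigroup `⟨2, m⟩` generated by `2` and `m`. -/
def gen2 (m : ℕ) : Set ℕ := {n | ∃ a b : ℕ, n = 2 * a + m * b}

/-- The underlying set of `S(i) = ⟨2, i⟩ ∩ T(i)`. -/
def Sset (i : ℕ) : Set ℕ := gen2 i ∩ Tset i

/-- The set of special gaps of `S`: gaps `g` such that `S ∪ {g}` is again a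
numerical semigroup. -/
def SpecialGaps (S : NumericalSemigroup) : Set ℕ :=
  {g | g ∉ S.carrier ∧ ∃ T : NumericalSemigroup, T.carrier = insert g S.carrier}

namespace NumericalSemigroup

/-- A numerical semigroup is irreducible as soon as some gap `g` satisfies `g - x ∈ S` for every
gap `x`. -/
theorem irred_of_symmetric (S : NumericalSemigroup) (g : ℕ) (hg : g ∉ S.carrier)
    (h : ∀ x ∉ S.carrier, x ≤ g ∧ g - x ∈ S.carrier) : S.Irred := by
  rintro ⟨A, B, hA, hB, hAB⟩
  have key : ∀ C : NumericalSemigroup, S.carrier ⊂ C.carrier → g ∈ C.carrier := by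
    intro C hC
    obtain ⟨x, hxC, hxS⟩ := Set.exists_of_ssubset hC
    obtain ⟨hle, hmem⟩ := h x hxS
    have := C.add_mem hxC (hC.1 hmem)
    rwa [Nat.add_sub_cancel' hle] at this
  exact hg (hAB ▸ ⟨key A hA, key B hB⟩)

theorem finite_compl_of_forall_ge {s : Set ℕ} (N : ℕ) (h : ∀ x, N ≤ x → x ∈ s) :
    (sᶜ : Set ℕ).Finite :=
  (Set.finite_Iio N).subset fun x hx => not_le.1 fun hN => hx (h x hN)

/-- The intersection of a finite family of numerical semigroups. -/
def iInter {n : ℕ} (F : Fin n → NumericalSemigroup) (J : Set (Fin n)) : NumericalSemigroup where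
  carrier := ⋂ j ∈ J, (F j).carrier
  zero_mem := Set.mem_iInter₂.2 fun j _ => (F j).zero_mem
  add_mem a b ha hb := Set.mem_iInter₂.2 fun j hj =>
    (F j).add_mem (Set.mem_iInter₂.1 ha j hj) (Set.mem_iInter₂.1 hb j hj)
  cofinite := by
    simp only [Set.compl_iInter]
    exact Set.finite_iUnion fun j => Set.finite_iUnion fun _ => (F j).cofinite

/-- The semigroup `⟨2, 2b + 1⟩`: the even numbers and everything from `2b` on. -/
def evens (b : ℕ) : NumericalSemigroup where
  carrier := {x | x % 2 = 0 ∨ 2 * b ≤ x}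
  zero_mem := Or.inl rfl
  add_mem x y hx hy := by simp only [Set.mem_ofPred_eq] at *; omega
  cofinite := finite_compl_of_forall_ge (2 * b) fun x hx => Or.inr hx

/-- The symmetric semigroup `T(2a + 1)`. -/
def upper (a : ℕ) : NumericalSemigroup where
  carrier := {x | x = 0 ∨ a + 1 ≤ x ∧ x ≠ 2 * a + 1}
  zero_mem := Or.inl rfl
  add_mem x y hx hy := by simp only [Set.mem_ofPred_eq] at *; omega
  cofinite := finite_compl_of_forall_ge (2 * a + 2) fun x hx => by
    simp only [Set.mem_ofPred_eq]; omega

/-- The semigroup `S(2q + 1)`. -/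
def evensUpper (q : ℕ) : NumericalSemigroup where
  carrier := {x | x = 0 ∨ q + 1 ≤ x ∧ (x % 2 = 0 ∨ 2 * q + 2 ≤ x)}
  zero_mem := Or.inl rfl
  add_mem x y hx hy := by simp only [Set.mem_ofPred_eq] at *; omega
  cofinite := finite_compl_of_forall_ge (2 * q + 2) fun x hx => by
    simp only [Set.mem_ofPred_eq]; omega

theorem mem_evens {b x : ℕ} : x ∈ (evens b).carrier ↔ x % 2 = 0 ∨ 2 * b ≤ x := Iff.rfl

theorem mem_upper {a x : ℕ} :
    x ∈ (upper a).carrier ↔ x = 0 ∨ a + 1 ≤ x ∧ x ≠ 2 * a + 1 := Iff.rfl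

theorem mem_evensUpper {q x : ℕ} :
    x ∈ (evensUpper q).carrier ↔ x = 0 ∨ q + 1 ≤ x ∧ (x % 2 = 0 ∨ 2 * q + 2 ≤ x) := Iff.rfl

theorem irred_evens {b : ℕ} (hb : 1 ≤ b) : (evens b).Irred := by
  apply irred_of_symmetric _ (2 * b - 1)
  · rw [mem_evens]; omega
  · intro x hx
    rw [mem_evens] at hx ⊢
    omega

theorem irred_upper (a : ℕ) : (upper a).Irred := by
  apply irred_of_symmetric _ (2 * a + 1)
  · rw [mem_upper]; omega
  · intro x hx
    rw [mem_upper] at hx ⊢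
    omega

/-- `S(2q + 1)` is the irredundant intersection of `⟨2, 2(q - n) + 5⟩` with the semigroups `T(f)`,
where `f` runs over the `n - 1` largest odd numbers up to `2q + 1`. -/
theorem hasFactorizationOfLength_evensUpper {n q : ℕ} (hn : 2 ≤ n) (hq : 2 * n ≤ q) :
    HasFactorizationOfLength (evensUpper q) n := by
  let F : Fin n → NumericalSemigroup := fun i =>
    if (i : ℕ) = 0 then evens (q + 2 - n) else upper (q + 1 - i)
  have mem_F : ∀ (i : Fin n) (x : ℕ), x ∈ (F i).carrier ↔
      ((i : ℕ) = 0 → x % 2 = 0 ∨ 2 * (q + 2 - n) ≤ x) ∧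
      ((i : ℕ) ≠ 0 → x = 0 ∨ q + 1 - i + 1 ≤ x ∧ x ≠ 2 * (q + 1 - i) + 1) := by
    intro i x
    by_cases hi : (i : ℕ) = 0 <;> simp [F, hi, mem_evens, mem_upper]
  refine ⟨F, fun i => ?_, ?_, ?_⟩
  · by_cases hi : (i : ℕ) = 0
    · simpa [F, hi] using irred_evens (b := q + 2 - n) (by omega)
    · simpa [F, hi] using irred_upper (q + 1 - i)
  · ext x
    simp only [Set.mem_iInter, mem_F, mem_evensUpper]
    constructor
    · intro hx i
      have := i.isLt
      omega
    · intro hx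
      by_contra hxS
      have h0 := (hx ⟨0, by omega⟩).1 rfl
      have h1 := (hx ⟨1, by omega⟩).2 one_ne_zero
      simp only at h1
      have h2 := (hx ⟨q + 1 - x / 2, by omega⟩).2
      simp only at h2
      omega
  · intro J hJ hS
    obtain ⟨i, hi⟩ := (Set.ne_univ_iff_exists_notMem J).1 hJ
    have hin := i.isLt
    -- the gap that only the factor with index `i` excludes
    obtain ⟨x, hx⟩ : ∃ x, x = if (i : ℕ) = 0 then 2 * (q + 2 - n) - 1 else 2 * (q + 1 - i) + 1 :=
      ⟨_, rfl⟩
    have hxS : x ∈ (evensUpper q).carrier := by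
      rw [hS, Set.mem_iInter₂]
      intro j hj
      have hij : (i : ℕ) ≠ j := fun h => hi (Fin.ext h ▸ hj)
      have hjn := j.isLt
      rw [mem_F]
      split_ifs at hx <;> omega
    rw [mem_evensUpper] at hxS
    split_ifs at hx <;> omega

/-- The intersection of an irredundant family of at least two numerical semigroups is not
irreducible. -/
theorem not_irred_of_isFactorization {S : NumericalSemigroup} {n : ℕ}
    {F : Fin n → NumericalSemigroup} (hF : IsFactorization S F) (hn : 2 ≤ n) : ¬ S.Irred := by
  obtain ⟨-, hS, hJ⟩ := hF
  have hsub : ∀ J : Set (Fin n), J ≠ Set.univ → S.carrier ⊂ (iInter F J).carrier := by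
    refine fun J hne => lt_of_le_of_ne ?_ (hJ J hne)
    rw [hS]
    exact fun x hx => Set.mem_iInter₂.2 fun j _ => Set.mem_iInter.1 hx j
  let z : Fin n := ⟨0, by omega⟩
  let o : Fin n := ⟨1, by omega⟩
  have hzo : o ≠ z := by simp [z, o]
  refine not_not.2 ⟨iInter F {z}, iInter F {z}ᶜ, hsub _ ?_, hsub _ ?_, ?_⟩
  · exact (Set.ne_univ_iff_exists_notMem _).2 ⟨o, hzo⟩
  · exact (Set.ne_univ_iff_exists_notMem _).2 ⟨z, by simp⟩
  · simp only [iInter, hS, ← Set.biInter_union, Set.union_compl_self, Set.biInter_univ]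

end NumericalSemigroup

/-- For every integer `k ≥ 2`, `𝒰ₖᵐ(𝔑) = ℕ_{≥2}`: for every integer `l`,
some numerical semigroup has both a factorization into irreducibles of length `k`
and one of length `l` iff `l ≥ 2`. -/
theorem unions_of_sets_of_lengths (k : ℕ) (hk : 2 ≤ k) (l : ℕ) :
    (∃ S : NumericalSemigroup,
        HasFactorizationOfLength S k ∧ HasFactorizationOfLength S l) ↔ 2 ≤ l := by
  constructor
  · rintro ⟨S, ⟨F, hF⟩, ⟨G, hG⟩⟩
    by_contra hl
    obtain rfl | rfl : l = 0 ∨ l = 1 := by omega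
    · refine hF.2.2 ∅ ?_ (by simpa using hG.2.1)
      exact (Set.ne_univ_iff_exists_notMem _).2 ⟨⟨0, by omega⟩, by simp⟩
    · have hS : S.carrier = (G 0).carrier := hG.2.1.trans (iInf_unique _)
      have hirr := hG.1 0
      refine NumericalSemigroup.not_irred_of_isFactorization hF hk ?_
      unfold NumericalSemigroup.Irred at hirr ⊢
      rwa [hS]
  · intro hl
    exact ⟨.evensUpper (2 * (k + l)),
      NumericalSemigroup.hasFactorizationOfLength_evensUpper hk (by omega),
      NumericalSemigroup.hasFactorizationOfLength_evensUpper hl (by omega)⟩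
end

section
/- For every positive real number M, there exists a numerical semigroup S admitting factorizations into irreducibles of lengths n and m with n/m > M; in other words, the elasticity ρᵐ(𝔑) = sup over numerical semigroups S of sup(Lᵐ(S))/min(Lᵐ(S)) is infinite. -/
/-- A numerical semigroup is irreducible as soon as some gap lies in every numerical semigroup
properly containing it. -/
theorem NumericalSemigroup.irred_of_gap {S : NumericalSemigroup} {f : ℕ} (hf : f ∉ S.carrier)
    (h : ∀ A : NumericalSemigroup, S.carrier ⊂ A.carrier → f ∈ A.carrier) : S.Irred := by
  rintro ⟨A, B, hA, hB, hS⟩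
  exact hf (hS ▸ ⟨h A hA, h B hB⟩)

/-- The numerical semigroup of all even numbers and all numbers at least `m`. -/
def evenOrGe (m : ℕ) : NumericalSemigroup where
  carrier := {x | Even x ∨ m ≤ x}
  zero_mem := Or.inl Even.zero
  add_mem := by
    rintro a b ha hb
    simp only [Set.mem_ofPred_eq, Nat.even_iff] at *
    omega
  cofinite := (Set.finite_Iio m).subset fun x hx => by
    simp only [Set.mem_compl_iff, Set.mem_ofPred_eq, not_or] at hx
    exact not_le.mp hx.2

theorem mem_evenOrGe {m x : ℕ} : x ∈ (evenOrGe m).carrier ↔ x % 2 = 0 ∨ m ≤ x := by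
  rw [← Nat.even_iff]; rfl

theorem evenOrGe_irred {m : ℕ} (hm : m % 2 = 1) (h3 : 3 ≤ m) : (evenOrGe m).Irred := by
  refine NumericalSemigroup.irred_of_gap (f := m - 2) (by rw [mem_evenOrGe]; omega) ?_
  intro A hA
  obtain ⟨hsub, x, hxA, hx⟩ := Set.ssubset_iff_exists.mp hA
  rw [mem_evenOrGe] at hx
  have hmem : m - 2 - x ∈ A.carrier := hsub (mem_evenOrGe.mpr (by omega))
  have := A.add_mem hxA hmem
  rwa [show x + (m - 2 - x) = m - 2 by omega] at this

/-- The numerical semigroup consisting of `0` and all numbers greater than `m / 2` other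
than `m`. -/
def gtHalf (m : ℕ) : NumericalSemigroup where
  carrier := {x | x = 0 ∨ m < 2 * x ∧ x ≠ m}
  zero_mem := Or.inl rfl
  add_mem := by
    rintro a b ha hb
    simp only [Set.mem_ofPred_eq] at *
    omega
  cofinite := (Set.finite_Iic m).subset fun x hx => by
    simp only [Set.mem_compl_iff, Set.mem_ofPred_eq, Set.mem_Iic] at *
    omega

theorem mem_gtHalf {m x : ℕ} : x ∈ (gtHalf m).carrier ↔ x = 0 ∨ m < 2 * x ∧ x ≠ m := Iff.rfl

theorem gtHalf_irred {m : ℕ} (hm : 0 < m) : (gtHalf m).Irred := by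
  refine NumericalSemigroup.irred_of_gap (f := m) (by rw [mem_gtHalf]; omega) ?_
  intro A hA
  obtain ⟨hsub, x, hxA, hx⟩ := Set.ssubset_iff_exists.mp hA
  rw [mem_gtHalf] at hx
  by_cases hxm : x = m
  · exact hxm ▸ hxA
  have hmem : m - x ∈ A.carrier := by
    by_cases h : m - x = x
    · rwa [h]
    · exact hsub (mem_gtHalf.mpr (by omega))
  have := A.add_mem hxA hmem
  rwa [show x + (m - x) = m by omega] at this

/-- An intersection of irreducibles is a factorization if each factor omits an element common to
all the other factors. -/
theorem isFactorization_of_witness {S : NumericalSemigroup} {n : ℕ}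
    {F : Fin n → NumericalSemigroup} (hF : ∀ j, (F j).Irred)
    (hS : ∀ x, x ∈ S.carrier ↔ ∀ j, x ∈ (F j).carrier)
    (w : Fin n → ℕ) (hw : ∀ j k, w j ∈ (F k).carrier ↔ j ≠ k) : IsFactorization S F := by
  refine ⟨hF, by ext x; simp [hS], fun J hJ h => ?_⟩
  obtain ⟨j, hj⟩ := (Set.ne_univ_iff_exists_notMem J).mp hJ
  have hmem : w j ∈ S.carrier := by
    rw [h]
    simp only [Set.mem_iInter]
    exact fun k hk => (hw j k).mpr (by rintro rfl; exact hj hk)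
  exact (hw j j).mp ((hS _).mp hmem j) rfl

/-- The intersection of `⟨2, 8p - 1⟩` with `T(8p - 1)`. -/
def twoFactorSemigroup (p : ℕ) : NumericalSemigroup where
  carrier := (evenOrGe (8 * p - 1)).carrier ∩ (gtHalf (8 * p - 1)).carrier
  zero_mem := ⟨(evenOrGe _).zero_mem, (gtHalf _).zero_mem⟩
  add_mem _ _ ha hb := ⟨(evenOrGe _).add_mem ha.1 hb.1, (gtHalf _).add_mem ha.2 hb.2⟩
  cofinite := by
    rw [Set.compl_inter]
    exact (evenOrGe _).cofinite.union (gtHalf _).cofinite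

theorem mem_twoFactorSemigroup {p x : ℕ} : x ∈ (twoFactorSemigroup p).carrier ↔
    (x % 2 = 0 ∨ 8 * p - 1 ≤ x) ∧ (x = 0 ∨ 8 * p - 1 < 2 * x ∧ x ≠ 8 * p - 1) := by
  rw [← mem_evenOrGe, ← mem_gtHalf]; rfl

theorem twoFactorSemigroup_hasFactorization_two {p : ℕ} (hp : 0 < p) :
    HasFactorizationOfLength (twoFactorSemigroup p) 2 := by
  refine ⟨![evenOrGe (8 * p - 1), gtHalf (8 * p - 1)],
    isFactorization_of_witness ?_ ?_ ![8 * p - 3, 8 * p - 1] ?_⟩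
  · rw [Fin.forall_fin_two]
    exact ⟨evenOrGe_irred (by omega) (by omega), gtHalf_irred (by omega)⟩
  · intro x
    rw [Fin.forall_fin_two]
    rfl
  · simp only [Fin.forall_fin_two, Matrix.cons_val_zero, Matrix.cons_val_one, mem_evenOrGe,
      mem_gtHalf, ne_eq, zero_ne_one, one_ne_zero, not_true_eq_false, not_false_eq_true,
      iff_true, iff_false, and_false, or_false]
    omega

theorem twoFactorSemigroup_hasFactorization_succ {p : ℕ} (hp : 0 < p) :
    HasFactorizationOfLength (twoFactorSemigroup p) (p + 1) := by
  refine ⟨Fin.cons (evenOrGe (8 * p + 1)) fun j : Fin p => gtHalf (2 * (p + j)),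
    isFactorization_of_witness ?_ ?_ (Fin.cons (8 * p - 1) fun j : Fin p => 2 * (p + j)) ?_⟩
  · rw [Fin.forall_fin_succ]
    exact ⟨evenOrGe_irred (by omega) (by omega), fun j => gtHalf_irred (by omega)⟩
  · intro x
    simp only [Fin.forall_fin_succ, Fin.cons_zero, Fin.cons_succ, mem_evenOrGe, mem_gtHalf,
      mem_twoFactorSemigroup]
    constructor
    · intro h
      refine ⟨by omega, fun j => ?_⟩
      have := j.isLt
      omega
    · rintro ⟨h, hT⟩
      have hlast := hT ⟨p - 1, by omega⟩
      simp only at hlast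
      by_cases hx : x % 2 = 0 ∧ 2 * p ≤ x ∧ x < 4 * p
      · have := hT ⟨x / 2 - p, by omega⟩
        simp only at this
        omega
      · omega
  · simp only [Fin.forall_fin_succ, Fin.cons_zero, Fin.cons_succ, mem_evenOrGe, mem_gtHalf,
      ne_eq, Fin.ext_iff, Fin.val_zero, Fin.val_succ, not_true_eq_false, iff_false]
    refine ⟨⟨by omega, fun k => ?_⟩, fun j => ⟨by omega, fun k => ?_⟩⟩
    · have := k.isLt
      omega
    · have := j.isLt
      have := k.isLt
      omega

/-- The elasticity of `(𝔑, ∩)` is infinite: for every positive real `M`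
there is a numerical semigroup with factorizations into irreducibles of lengths
`n` and `m` with `n / m > M`. -/
theorem elasticity_infinite (M : ℝ) (hM : 0 < M) :
    ∃ (S : NumericalSemigroup) (n m : ℕ),
      HasFactorizationOfLength S n ∧ HasFactorizationOfLength S m ∧
      (n : ℝ) / (m : ℝ) > M := by
  refine ⟨twoFactorSemigroup (⌈2 * M⌉₊ + 1), _, _,
    twoFactorSemigroup_hasFactorization_succ (Nat.succ_pos _),
    twoFactorSemigroup_hasFactorization_two (Nat.succ_pos _), ?_⟩
  have := Nat.le_ceil (2 * M)
  push_cast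
  linarith
end

section
/- Let i be an odd integer with i ≡ 3 (mod 4) and i ≥ 7 (so that (i+1)/2 is even). Then the set of special gaps of S(i) is SG(S(i)) = ([(i+1)/4, (i−1)/2] ∩ 2ℕ) ∪ {(i+1)/2 + 2k + 1 : k ∈ {0, 1, …, (i−3)/4}}, where 2ℕ denotes the set of even natural numbers. -/
theorem mem_Sset_iff {i : ℕ} (hi : i % 4 = 3) (n : ℕ) :
    n ∈ Sset i ↔ n = 0 ∨ (n % 2 = 0 ∧ (i + 1) / 2 ≤ n) ∨ i + 2 ≤ n := by
  simp only [Sset, gen2, Tset, Set.mem_inter_iff, Set.mem_ofPred_eq, Set.mem_union,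
    Set.mem_singleton_iff, Set.mem_Icc, Set.mem_Ici]
  constructor
  · rintro ⟨⟨a, b, hab⟩, h⟩
    rcases b with _ | b
    · omega
    · have : i ≤ i * (b + 1) := Nat.le_mul_of_pos_right i b.succ_pos
      rcases b with _ | b
      · omega
      · have : i * 2 ≤ i * (b + 1 + 1) := Nat.mul_le_mul_left i (by omega)
        omega
  · intro h
    refine ⟨?_, by omega⟩
    rcases Nat.mod_two_eq_zero_or_one n with hn | hn
    · exact ⟨n / 2, 0, by omega⟩
    · exact ⟨(n - i) / 2, 1, by omega⟩

/-- A gap `g` of `S` is special iff `2 * g` and all `g + s` with `s ∈ S` lie in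
`S ∪ {g}`. -/
theorem mem_SpecialGaps_iff (S : NumericalSemigroup) (g : ℕ) :
    g ∈ SpecialGaps S ↔ g ∉ S.carrier ∧ g + g ∈ insert g S.carrier ∧
      ∀ s ∈ S.carrier, g + s ∈ insert g S.carrier := by
  constructor
  · rintro ⟨hg, T, hT⟩
    refine ⟨hg, ?_, fun s hs => ?_⟩
    · rw [← hT]
      exact T.add_mem (by simp [hT]) (by simp [hT])
    · rw [← hT]
      exact T.add_mem (by simp [hT]) (by simp [hT, hs])
  · rintro ⟨hg, hgg, hgs⟩
    refine ⟨hg, ⟨insert g S.carrier, Or.inr S.zero_mem, ?_,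
      S.cofinite.subset (Set.compl_subset_compl.mpr (Set.subset_insert g S.carrier))⟩, rfl⟩
    rintro a b (rfl | ha) (rfl | hb)
    · exact hgg
    · exact hgs b hb
    · rw [add_comm]
      exact hgs a ha
    · exact Or.inr (S.add_mem ha hb)

/-- For odd `i ≡ 3 (mod 4)`, `i ≥ 7`,
`SG(S(i)) = ([(i+1)/4, (i-1)/2] ∩ 2ℕ) ∪ {(i+1)/2 + 2k + 1 : 0 ≤ k ≤ (i-3)/4}`. -/
theorem special_gaps_Si_case_even (i : ℕ) (hi : i % 4 = 3) (hi7 : 7 ≤ i)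
    (S : NumericalSemigroup) (hS : S.carrier = Sset i) :
    SpecialGaps S =
      (Set.Icc ((i + 1) / 4) ((i - 1) / 2) ∩ {n : ℕ | Even n}) ∪
        {g : ℕ | ∃ k ≤ (i - 3) / 4, g = (i + 1) / 2 + 2 * k + 1} := by
  ext g
  simp only [mem_SpecialGaps_iff, hS, Set.mem_insert_iff, mem_Sset_iff hi, Set.mem_union,
    Set.mem_inter_iff, Set.mem_Icc, Set.mem_ofPred_eq, Nat.even_iff]
  constructor
  · rintro ⟨hg, hgg, hgs⟩
    have h := hgs ((i + 1) / 2) (by omega)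
    rcases Nat.mod_two_eq_zero_or_one g with hn | hn
    · left
      omega
    · exact Or.inr ⟨(g - (i + 1) / 2 - 1) / 2, by omega, by omega⟩
  · rintro (h | ⟨k, hk, rfl⟩)
    · exact ⟨by omega, by omega, fun s hs => by omega⟩
    · exact ⟨by omega, by omega, fun s hs => by omega⟩
end

section
/- Let i be an odd integer with i ≡ 1 (mod 4) and i ≥ 5 (so that (i+1)/2 is odd). Then the set of special gaps of S(i) is SG(S(i)) = ([(i+3)/4, (i−1)/2] ∩ 2ℕ) ∪ {(i+1)/2 + 2k : k ∈ {0, 1, …, (i−1)/4}}, where 2ℕ denotes the set of even natural numbers. -/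
/-- Explicit description of `S(i)` for `i = 4 * m + 1`. -/
theorem mem_Sset_four_mul_add_one {m : ℕ} (n : ℕ) :
    n ∈ Sset (4 * m + 1) ↔ n = 0 ∨ (n % 2 = 0 ∧ 2 * m + 2 ≤ n) ∨ 4 * m + 2 ≤ n := by
  simp only [Sset, gen2, Tset, Set.mem_inter_iff, Set.mem_ofPred_eq, Set.mem_union,
    Set.mem_singleton_iff, Set.mem_Icc, Set.mem_Ici]
  constructor
  · rintro ⟨⟨a, b, h⟩, hT⟩
    rcases b with _ | b
    · omega
    · have : 4 * m + 1 ≤ (4 * m + 1) * (b + 1) := Nat.le_mul_of_pos_right _ b.succ_pos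
      omega
  · intro h
    refine ⟨?_, by omega⟩
    rcases Nat.mod_two_eq_zero_or_one n with h0 | h1
    · exact ⟨n / 2, 0, by omega⟩
    · exact ⟨(n - (4 * m + 1)) / 2, 1, by omega⟩

/-- For odd `i ≡ 1 (mod 4)`, `i ≥ 5`,
`SG(S(i)) = ([(i+3)/4, (i-1)/2] ∩ 2ℕ) ∪ {(i+1)/2 + 2k : 0 ≤ k ≤ (i-1)/4}`. -/
theorem special_gaps_Si_case_odd (i : ℕ) (hi : i % 4 = 1) (hi5 : 5 ≤ i)
    (S : NumericalSemigroup) (hS : S.carrier = Sset i) :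
    SpecialGaps S =
      (Set.Icc ((i + 3) / 4) ((i - 1) / 2) ∩ {n : ℕ | Even n}) ∪
        {g : ℕ | ∃ k ≤ (i - 1) / 4, g = (i + 1) / 2 + 2 * k} := by
  obtain ⟨m, rfl⟩ : ∃ m, i = 4 * m + 1 := ⟨i / 4, by omega⟩
  ext g
  simp only [mem_SpecialGaps_iff, hS, Set.mem_insert_iff, mem_Sset_four_mul_add_one,
    Set.mem_union, Set.mem_inter_iff, Set.mem_Icc, Set.mem_ofPred_eq, Nat.even_iff]
  constructor
  · rintro ⟨hg, hgg, hgs⟩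
    have hs := hgs (2 * m + 2) (by omega)
    rcases Nat.mod_two_eq_zero_or_one g with h0 | h1
    · left
      omega
    · right
      exact ⟨(g - (2 * m + 1)) / 2, by omega, by omega⟩
  · rintro (h | ⟨k, hk, h⟩)
    · exact ⟨by omega, by omega, fun s hs => by omega⟩
    · exact ⟨by omega, by omega, fun s hs => by omega⟩
end

section
/- Let i be an odd integer with i ≡ 3 (mod 4) and i ≥ 7 (so that (i+1)/2 is even). Then, as a set, S(i) = {0} ∪ {(i+1)/2 + 2m : m ∈ {0, 1, …, (i−3)/4}} ∪ {n ∈ ℕ : n ≥ i+1}; equivalently, S(i) = {0, (i+1)/2, (i+1)/2 + 2, …, i−1} ∪ {i+1, i+2, …}. -/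
/-- For odd `m`, the semigroup `⟨2, m⟩` consists of the even numbers and the numbers `≥ m`. -/
theorem mem_gen2_iff_of_odd {m n : ℕ} (hm : m % 2 = 1) :
    n ∈ gen2 m ↔ n % 2 = 0 ∨ m ≤ n := by
  constructor
  · rintro ⟨a, b, rfl⟩
    rcases b with _ | b
    · left; simp
    · right; rw [Nat.mul_succ]; omega
  · intro h
    rcases Nat.mod_two_eq_zero_or_one n with hn | hn
    · exact ⟨n / 2, 0, by omega⟩
    · exact ⟨(n - m) / 2, 1, by omega⟩

/-- For odd `i ≡ 3 (mod 4)`, `i ≥ 7`,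
`S(i) = {0} ∪ {(i+1)/2 + 2m : 0 ≤ m ≤ (i-3)/4} ∪ {n : n ≥ i+1}`. -/
theorem Sset_description_case_even (i : ℕ) (hi : i % 4 = 3) (hi7 : 7 ≤ i) :
    Sset i =
      {0} ∪ {n : ℕ | ∃ m ≤ (i - 3) / 4, n = (i + 1) / 2 + 2 * m} ∪
        Set.Ici (i + 1) := by
  ext n
  simp only [Sset, Tset, Set.mem_inter_iff, mem_gen2_iff_of_odd (show i % 2 = 1 by omega),
    Set.mem_union, Set.mem_singleton_iff, Set.mem_Icc, Set.mem_Ici, Set.mem_ofPred_eq]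
  constructor
  · rintro ⟨h, (h0 | h1) | h2⟩
    · exact Or.inl (Or.inl h0)
    · exact Or.inl (Or.inr ⟨(n - (i + 1) / 2) / 2, by omega, by omega⟩)
    · exact Or.inr h2
  · rintro ((h0 | ⟨m, hm, rfl⟩) | h2) <;> omega
end

section
/- Let i be an odd integer with i ≡ 1 (mod 4) and i ≥ 5 (so that (i+1)/2 is odd). Then, as a set, S(i) = {0} ∪ {(i+1)/2 + 1 + 2m : m ∈ {0, 1, …, (i−5)/4}} ∪ {n ∈ ℕ : n ≥ i+1}; equivalently, S(i) = {0, (i+1)/2 + 1, (i+1)/2 + 3, …, i−1} ∪ {i+1, i+2, …}. -/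
theorem mem_gen2_iff {m n : ℕ} (hm : Odd m) : n ∈ gen2 m ↔ Even n ∨ m ≤ n := by
  constructor
  · rintro ⟨a, b, rfl⟩
    rcases Nat.eq_zero_or_pos b with rfl | hb
    · simp
    · exact Or.inr ((Nat.le_mul_of_pos_right m hb).trans (Nat.le_add_left _ _))
  · intro h
    by_cases hn : Even n
    · exact ⟨n / 2, 0, by grind⟩
    · exact ⟨(n - m) / 2, 1, by grind⟩

/-- For odd `i ≡ 1 (mod 4)`, `i ≥ 5`,
`S(i) = {0} ∪ {(i+1)/2 + 1 + 2m : 0 ≤ m ≤ (i-5)/4} ∪ {n : n ≥ i+1}`. -/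
theorem Sset_description_case_odd (i : ℕ) (hi : i % 4 = 1) (hi5 : 5 ≤ i) :
    Sset i =
      {0} ∪ {n : ℕ | ∃ m ≤ (i - 5) / 4, n = (i + 1) / 2 + 1 + 2 * m} ∪
        Set.Ici (i + 1) := by
  ext n
  have hodd : Odd i := Nat.odd_iff.mpr (by omega)
  simp only [Sset, Tset, Set.mem_inter_iff, Set.mem_union, Set.mem_singleton_iff, Set.mem_Icc,
    Set.mem_Ici, Set.mem_ofPred_eq, mem_gen2_iff hodd, Nat.even_iff]
  constructor
  · rintro ⟨hgen, (rfl | hmid) | hlarge⟩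
    · simp
    · exact Or.inl (Or.inr ⟨(n - ((i + 1) / 2 + 1)) / 2, by omega, by omega⟩)
    · exact Or.inr hlarge
  · rintro ((rfl | ⟨m, hm, rfl⟩) | hlarge)
    · simp
    all_goals omega
end

section
/- Let k be a positive integer and let i be an odd integer with (i+1)/2 = 2k (that is, i = 4k − 1). Then the numerical semigroup S(i) admits a factorization into irreducibles of length k = (i+1)/4. -/
theorem mem_Tset_odd {m x : ℕ} :
    x ∈ Tset (2 * m + 1) ↔ x = 0 ∨ (m + 1 ≤ x ∧ x ≠ 2 * m + 1) := by
  simp only [Tset, Set.mem_union, Set.mem_singleton_iff, Set.mem_Icc, Set.mem_Ici]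
  omega

theorem mem_gen2_odd {m x : ℕ} :
    x ∈ gen2 (2 * m + 1) ↔ x % 2 = 0 ∨ 2 * m + 1 ≤ x := by
  constructor
  · rintro ⟨a, b, rfl⟩
    rcases b with _ | b
    · left
      simp
    · right
      have := Nat.le_mul_of_pos_right (2 * m + 1) (Nat.succ_pos b)
      exact this.trans (Nat.le_add_left _ _)
  · intro h
    rcases Nat.mod_two_eq_zero_or_one x with hx | hx
    · exact ⟨x / 2, 0, by omega⟩
    · exact ⟨(x - (2 * m + 1)) / 2, 1, by omega⟩

theorem mem_Sset {k x : ℕ} (hk : 0 < k) :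
    x ∈ Sset (4 * k - 1) ↔ x = 0 ∨ (2 * k ≤ x ∧ (x % 2 = 0 ∨ 4 * k + 1 ≤ x)) := by
  have h : 4 * k - 1 = 2 * (2 * k - 1) + 1 := by omega
  rw [h, Sset, Set.mem_inter_iff, mem_gen2_odd, mem_Tset_odd]
  omega

/-- `T(2m + 1)` as a numerical semigroup. -/
def oddT (m : ℕ) : NumericalSemigroup where
  carrier := Tset (2 * m + 1)
  zero_mem := mem_Tset_odd.2 (Or.inl rfl)
  add_mem a b ha hb := by
    rw [mem_Tset_odd] at *
    omega
  cofinite := (Set.finite_Iic (2 * m + 1)).subset fun x hx => by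
    rw [Set.mem_compl_iff, mem_Tset_odd] at hx
    rw [Set.mem_Iic]
    omega

theorem mem_oddT {m x : ℕ} :
    x ∈ (oddT m).carrier ↔ x = 0 ∨ (m + 1 ≤ x ∧ x ≠ 2 * m + 1) :=
  mem_Tset_odd

/-- `T(2m + 1)` is symmetric, so each proper oversemigroup contains its Frobenius number. -/
theorem frobenius_mem_of_oddT_ssubset {m : ℕ} {A : NumericalSemigroup}
    (h : (oddT m).carrier ⊂ A.carrier) : 2 * m + 1 ∈ A.carrier := by
  obtain ⟨x, hxA, hx⟩ := Set.exists_of_ssubset h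
  rw [mem_oddT] at hx
  by_cases hxm : x = 2 * m + 1
  · exact hxm ▸ hxA
  · have hy : 2 * m + 1 - x ∈ (oddT m).carrier := mem_oddT.2 (by omega)
    have hsum := A.add_mem hxA (h.subset hy)
    rwa [show x + (2 * m + 1 - x) = 2 * m + 1 by omega] at hsum

theorem oddT_irred (m : ℕ) : (oddT m).Irred := by
  rintro ⟨A, B, hA, hB, hAB⟩
  have h : 2 * m + 1 ∈ (oddT m).carrier :=
    hAB ▸ ⟨frobenius_mem_of_oddT_ssubset hA, frobenius_mem_of_oddT_ssubset hB⟩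
  rw [mem_oddT] at h
  omega

/-- For a positive integer `k` and `i = 4k - 1` (so `(i+1)/2 = 2k`),
the numerical semigroup `S(i)` admits a factorization into irreducibles of
length `k = (i+1)/4`. -/
theorem factorization_of_length_k (k : ℕ) (hk : 0 < k)
    (S : NumericalSemigroup) (hS : S.carrier = Sset (4 * k - 1)) :
    HasFactorizationOfLength S k := by
  refine ⟨fun j => oddT (k + j), fun j => oddT_irred _, ?_, ?_⟩
  · ext x
    rw [hS, mem_Sset hk, Set.mem_iInter]
    simp only [mem_oddT]
    constructor
    · intro h j
      have := j.isLt
      omega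
    · intro h
      have hlast := h ⟨k - 1, by omega⟩
      dsimp only at hlast
      by_cases hx : 2 * k + 1 ≤ x ∧ x ≤ 4 * k
      · have hmid := h ⟨(x - (2 * k + 1)) / 2, by omega⟩
        dsimp only at hmid
        omega
      · omega
  · intro J hJ hSJ
    obtain ⟨j, hj⟩ := (Set.ne_univ_iff_exists_notMem J).1 hJ
    have hmem : 2 * (k + j) + 1 ∈ ⋂ l ∈ J, (oddT (k + l)).carrier := by
      refine Set.mem_iInter₂.2 fun l hl => mem_oddT.2 (Or.inr ?_)
      have hne : (l : ℕ) ≠ j := fun h => hj (Fin.ext h ▸ hl)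
      have := l.isLt
      omega
    rw [← hSJ, hS, mem_Sset hk] at hmem
    have := j.isLt
    omega
end

section
/- Let i be an odd integer with i ≡ 3 (mod 4) and i ≥ 7 (so that (i+1)/2 is even). Then every special gap g of S(i) with g < (i+1)/2 is even and satisfies g ≥ (i+1)/4; in particular, no odd positive integer below (i+1)/2 is a special gap of S(i). -/
/-- A nonzero element of `S(m)` is at least `(m + 1) / 2`. -/
theorem half_le_of_mem_Sset {m x : ℕ} (hx : x ∈ Sset m) (h0 : x ≠ 0) : (m + 1) / 2 ≤ x := by
  obtain ⟨-, (h | h) | h⟩ := hx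
  · exact absurd h h0
  · exact h.1
  · have : m + 1 ≤ x := h
    omega

/-- An odd element of `S(m)` exceeds `m`. -/
theorem lt_of_mem_Sset_of_odd {m x : ℕ} (hx : x ∈ Sset m) (hodd : Odd x) : m < x := by
  obtain ⟨⟨a, b, hab⟩, hT⟩ := hx
  have hb : b ≠ 0 := by
    rintro rfl
    obtain ⟨c, hc⟩ := hodd
    omega
  have hmx : m ≤ x := by
    have := Nat.le_mul_of_pos_right m (Nat.pos_of_ne_zero hb)
    omega
  obtain ⟨c, hc⟩ := hodd
  rcases hT with (h | h) | h
  · have : x = 0 := h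
    omega
  · have : x ≤ m - 1 := h.2
    omega
  · exact h

/-- If `m ≡ 3 (mod 4)`, then `(m + 1) / 2` belongs to `S(m)`. -/
theorem half_mem_Sset {m : ℕ} (hm : m % 4 = 3) : (m + 1) / 2 ∈ Sset m :=
  ⟨⟨(m + 1) / 4, 0, by omega⟩, Or.inl (Or.inr ⟨le_rfl, by omega⟩)⟩

/-- For odd `i ≡ 3 (mod 4)`, `i ≥ 7`, every special gap `g` of `S(i)`
with `g < (i+1)/2` is even and satisfies `g ≥ (i+1)/4`. -/
theorem special_gaps_below_half (i : ℕ) (hi : i % 4 = 3) (hi7 : 7 ≤ i)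
    (S : NumericalSemigroup) (hS : S.carrier = Sset i)
    (g : ℕ) (hg : g ∈ SpecialGaps S) (hlt : g < (i + 1) / 2) :
    Even g ∧ (i + 1) / 4 ≤ g := by
  obtain ⟨hgS, T, hT⟩ := hg
  rw [hS] at hT hgS
  have hgT : g ∈ T.carrier := hT ▸ Set.mem_insert g _
  have hg0 : g ≠ 0 := by
    rintro rfl
    exact hgS (hS ▸ S.zero_mem)
  have add_mem_Sset {x : ℕ} (hx : x ∈ T.carrier) (hx0 : x ≠ 0) : g + x ∈ Sset i := by
    have h := T.add_mem hgT hx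
    rw [hT] at h
    exact h.resolve_left (by omega)
  have heven : Even g := by
    rw [← Nat.not_odd_iff_even]
    rintro ⟨c, hc⟩
    have hhalf : (i + 1) / 2 ∈ T.carrier := hT ▸ Set.mem_insert_of_mem g (half_mem_Sset hi)
    have h := lt_of_mem_Sset_of_odd (add_mem_Sset hhalf (by omega))
      ⟨c + (i + 1) / 4, by omega⟩
    omega
  have h := half_le_of_mem_Sset (add_mem_Sset hgT hg0) (by omega)
  exact ⟨heven, by omega⟩
end

section
/- Let S be a numerical semigroup with S ≠ ℕ. Then the length of any factorization of S into irreducibles is at most the cardinality of the set SG(S) of special gaps of S. -/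
/-- The largest element of an additively closed set `T ⊋ S` outside of `S` is a special gap
of `S`. -/
theorem exists_mem_specialGaps_of_ssubset (S : NumericalSemigroup) {T : Set ℕ}
    (hT : ∀ a ∈ T, ∀ b ∈ T, a + b ∈ T) (hST : S.carrier ⊂ T) :
    ∃ g ∈ T, g ∈ SpecialGaps S := by
  obtain ⟨hsub, x, hxT, hxS⟩ := Set.ssubset_iff_exists.mp hST
  have hfin : (T \ S.carrier).Finite := S.cofinite.subset fun _ h => h.2
  obtain ⟨g, ⟨hgT, hgS⟩, hmax⟩ := hfin.exists_maximal ⟨x, hxT, hxS⟩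
  have mem_of_lt : ∀ a ∈ T, g < a → a ∈ S.carrier := fun a ha hlt => by
    by_contra h
    exact absurd (hmax ⟨ha, h⟩ hlt.le) hlt.not_ge
  have hg0 : 0 < g := Nat.pos_of_ne_zero fun h => hgS (h ▸ S.zero_mem)
  have add_mem_insert : ∀ s ∈ S.carrier, g + s ∈ insert g S.carrier := fun s hs => by
    rcases Nat.eq_zero_or_pos s with rfl | hpos
    · simp
    · exact Or.inr (mem_of_lt _ (hT g hgT s (hsub hs)) (by omega))
  refine ⟨g, hgT, hgS, ⟨insert g S.carrier, Or.inr S.zero_mem, ?_, ?_⟩, rfl⟩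
  · rintro a b (rfl | ha) (rfl | hb)
    · exact Or.inr (mem_of_lt _ (hT _ hgT _ hgT) (by omega))
    · exact add_mem_insert b hb
    · rw [add_comm]
      exact add_mem_insert a ha
    · exact Or.inr (S.add_mem ha hb)
  · exact S.cofinite.subset (Set.compl_subset_compl.mpr (Set.subset_insert _ _))

/-- For a numerical semigroup `S ≠ ℕ`, the length of any
factorization of `S` into irreducibles is at most the number of special gaps of `S`. -/
theorem length_le_card_special_gaps (S : NumericalSemigroup)
    (hS : S.carrier ≠ Set.univ)
    (n : ℕ) (F : Fin n → NumericalSemigroup) (hF : IsFactorization S F) :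
    n ≤ (SpecialGaps S).ncard := by
  obtain ⟨-, hinter, hirr⟩ := hF
  have key : ∀ j, ∃ g, g ∈ SpecialGaps S ∧ ∀ k, k ≠ j → g ∈ (F k).carrier := fun j => by
    have hne : ({j}ᶜ : Set (Fin n)) ≠ Set.univ := fun h => by
      simpa using h.ge (Set.mem_univ j)
    have hsub : S.carrier ⊆ ⋂ k ∈ ({j}ᶜ : Set (Fin n)), (F k).carrier := fun x hx => by
      rw [hinter, Set.mem_iInter] at hx
      exact Set.mem_iInter₂.mpr fun k _ => hx k
    obtain ⟨g, hgT, hg⟩ := exists_mem_specialGaps_of_ssubset S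
      (fun a ha b hb => by
        rw [Set.mem_iInter₂] at ha hb ⊢
        exact fun k hk => (F k).add_mem (ha k hk) (hb k hk))
      (hsub.ssubset_of_ne (hirr _ hne))
    exact ⟨g, hg, fun k hk => Set.mem_iInter₂.mp hgT k hk⟩
  choose g hg hgF using key
  have hinj : Function.Injective g := fun i j hij => by
    by_contra hne
    refine (hg i).1 ?_
    rw [hinter, Set.mem_iInter]
    intro k
    by_cases hk : k = i
    · rw [hij]
      exact hgF j k (hk ▸ hne)
    · exact hgF i k hk
  have hfin : (SpecialGaps S).Finite := S.cofinite.subset fun _ h => h.1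
  calc n = (Set.range g).ncard := by
        rw [← Set.image_univ, Set.ncard_image_of_injective _ hinj, Set.ncard_univ, Nat.card_fin]
    _ ≤ (SpecialGaps S).ncard := Set.ncard_le_ncard (Set.range_subset_iff.mpr hg) hfin
end
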